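/- arXiv:1710.08093 — 3 statements merged into one kernel-verified Lean document; each statement's English description precedes it below -/
import Mathlib

section
/- Let E be a Banach space, p ≥ 1, f : [a,b] → E, ϖ a control on [a,b], L > 0 and M ≥ 0. Suppose there exists a partition a = s_0 < s_1 < ⋯ < s_J = b with ϖ(s_j, s_{j+1}) ≤ L for all j, and that for every finite partition (t_i)_{i=0}^n of [a,b] satisfying ϖ(t_i, t_{i+1}) ≤ L for all i one has Σ_{i=0}^{n−1} |f(t_{i+1}) − f(t_i)|_E^p ≤ M^p. Then f has finite p-variation on [a,b]: for every finite partition (t_i)_{i=0}^n of [a,b] (with no restriction on the mesh), Σ_{i=0}^{n−1} |f(t_{i+1}) − f(t_i)|_E^p ≤ (J+1)^{p−1} M^p; in particular |δf|_{p-var;[a,b]}^p ≤ (J+1)^{p−1} M^p. Hence the local p-variation space defined through the control ϖ and threshold L coincides with the usual p-variation space for one-index paths. -/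
/-- Admissible chains from `s` to `t` with `k` steps and `p`-variation sum `S`. -/
inductive AdmChain {E : Type*} [NormedAddCommGroup E] (p L : ℝ) (f : ℝ → E) (ϖ : ℝ → ℝ → ℝ) :
    ℕ → ℝ → ℝ → ℝ → Prop
  | nil (s : ℝ) : AdmChain p L f ϖ 0 s s 0
  | snoc {k : ℕ} {s t r S : ℝ} (h : AdmChain p L f ϖ k s t S) (htr : t < r) (hL : ϖ t r ≤ L) :
      AdmChain p L f ϖ (k + 1) s r (S + ‖f r - f t‖ ^ p)

theorem AdmChain.trans {E : Type*} [NormedAddCommGroup E] {p L : ℝ} {f : ℝ → E}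
    {ϖ : ℝ → ℝ → ℝ} {k l : ℕ} {s t r S T : ℝ} (h1 : AdmChain p L f ϖ k s t S)
    (h2 : AdmChain p L f ϖ l t r T) : AdmChain p L f ϖ (k + l) s r (S + T) := by
  induction h2 with
  | nil => simpa using h1
  | snoc h htr hL ih =>
    have := (ih h1).snoc htr hL
    rwa [add_assoc, add_assoc] at this

theorem AdmChain.exists_fun {E : Type*} [NormedAddCommGroup E] {p L : ℝ} {f : ℝ → E}
    {ϖ : ℝ → ℝ → ℝ} {k : ℕ} {s t S : ℝ} (h : AdmChain p L f ϖ k s t S) :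
    ∃ u : ℕ → ℝ, u 0 = s ∧ u k = t ∧ (∀ i < k, u i < u (i + 1)) ∧
      (∀ i < k, ϖ (u i) (u (i + 1)) ≤ L) ∧
      ∑ i ∈ Finset.range k, ‖f (u (i + 1)) - f (u i)‖ ^ p = S := by
  induction h with
  | nil s => exact ⟨fun _ => s, by simp⟩
  | @snoc k s t r S h htr hL ih =>
    obtain ⟨u, h0, hk, hm, hl, hs⟩ := ih
    have e : ∀ i, i ≤ k → (fun i => if i ≤ k then u i else r) i = u i := fun i hi => if_pos hi
    have e' : (fun i => if i ≤ k then u i else r) (k + 1) = r := if_neg (by omega)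
    generalize (fun i => if i ≤ k then u i else r) = v at e e'
    refine ⟨v, by rw [e 0 (by omega), h0], e', ?_, ?_, ?_⟩
    · intro i hi
      rcases Nat.lt_succ_iff_lt_or_eq.1 hi with h | rfl
      · rw [e i (by omega), e (i + 1) (by omega)]; exact hm i h
      · rw [e i le_rfl, e', hk]; exact htr
    · intro i hi
      rcases Nat.lt_succ_iff_lt_or_eq.1 hi with h | rfl
      · rw [e i (by omega), e (i + 1) (by omega)]; exact hl i h
      · rw [e i le_rfl, e', hk]; exact hL
    · rw [Finset.sum_range_succ, e', e k le_rfl, hk, ← hs]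
      congr 1
      refine Finset.sum_congr rfl fun i hi => ?_
      have := Finset.mem_range.1 hi
      rw [e i (by omega), e (i + 1) (by omega)]

theorem AdmChain.bound {E : Type*} [NormedAddCommGroup E] {p L : ℝ} (hp : 1 ≤ p) {f : ℝ → E}
    {ϖ : ℝ → ℝ → ℝ} {k : ℕ} {s t S : ℝ} (h : AdmChain p L f ϖ k s t S) :
    0 ≤ S ∧ ‖f t - f s‖ ^ p ≤ (k : ℝ) ^ (p - 1) * S := by
  obtain ⟨u, h0, hk, -, -, hs⟩ := h.exists_fun
  constructor
  · rw [← hs]; exact Finset.sum_nonneg fun i _ => by positivity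
  · have h1 := Real.rpow_sum_le_const_mul_sum_rpow (Finset.range k)
      (fun i => ‖f (u (i + 1)) - f (u i)‖) hp
    simp only [abs_norm, Finset.card_range, hs] at h1
    refine le_trans ?_ h1
    have h2 : f t - f s = ∑ i ∈ Finset.range k, (f (u (i + 1)) - f (u i)) := by
      rw [Finset.sum_range_sub (fun i => f (u i)), h0, hk]
    rw [h2]
    exact Real.rpow_le_rpow (norm_nonneg _) (norm_sum_le _ _) (by linarith)

/-- A path whose increments have `p`-variation bounded by `M^p` along all partitions with
mesh controlled by `ϖ(t_i,t_{i+1}) ≤ L` has finite global `p`-variation, with the bound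
`(J+1)^(p-1) * M^p` along arbitrary partitions, where `J` is the number of intervals of a
fixed `ϖ`-admissible partition of `[a,b]`. Hence the local `p`-variation space coincides with
the usual `p`-variation space for one-index paths. -/
theorem local_pvar_eq_global_pvar
    {E : Type*} [NormedAddCommGroup E] [NormedSpace ℝ E] [CompleteSpace E]
    (p : ℝ) (hp : 1 ≤ p) (a b : ℝ) (hab : a ≤ b) (f : ℝ → E)
    (ϖ : ℝ → ℝ → ℝ)
    (hϖ_nonneg : ∀ s t, a ≤ s → s ≤ t → t ≤ b → 0 ≤ ϖ s t)
    (hϖ_super : ∀ s θ t, a ≤ s → s ≤ θ → θ ≤ t → t ≤ b → ϖ s θ + ϖ θ t ≤ ϖ s t)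
    (hϖ_cont : ContinuousOn (fun q : ℝ × ℝ => ϖ q.1 q.2)
      {q : ℝ × ℝ | a ≤ q.1 ∧ q.1 ≤ q.2 ∧ q.2 ≤ b})
    (hϖ_zero : ∀ s, a ≤ s → s ≤ b → ϖ s s = 0)
    (L : ℝ) (hL : 0 < L) (M : ℝ) (hM : 0 ≤ M)
    (J : ℕ) (σ : ℕ → ℝ) (hσ0 : σ 0 = a) (hσJ : σ J = b)
    (hσ_mono : ∀ j < J, σ j < σ (j + 1))
    (hσ_L : ∀ j < J, ϖ (σ j) (σ (j + 1)) ≤ L)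
    (hf : ∀ (n : ℕ) (τ : ℕ → ℝ), τ 0 = a → τ n = b →
      (∀ i < n, τ i < τ (i + 1)) → (∀ i < n, ϖ (τ i) (τ (i + 1)) ≤ L) →
      ∑ i ∈ Finset.range n, ‖f (τ (i + 1)) - f (τ i)‖ ^ p ≤ M ^ p) :
    ∀ (n : ℕ) (τ : ℕ → ℝ), τ 0 = a → τ n = b → (∀ i < n, τ i < τ (i + 1)) →
      ∑ i ∈ Finset.range n, ‖f (τ (i + 1)) - f (τ i)‖ ^ p
        ≤ (J + 1 : ℝ) ^ (p - 1) * M ^ p := by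
  have key : ∀ j ≤ J, a ≤ σ j ∧ σ j ≤ b → ∀ s t, a ≤ s → s < t → t ≤ σ j →
      ∃ k ≤ j, ∃ S, AdmChain p L f ϖ k s t S := by
    intro j
    induction j with
    | zero => intro _ _ s t h1 h2 h3; rw [hσ0] at h3; linarith
    | succ j ih =>
      intro hj hb s t h1 h2 h3
      have hm := hσ_mono j (by omega)
      have haj : a ≤ σ j := by
        have : ∀ i ≤ J, a ≤ σ i := by
          intro i
          induction i with
          | zero => intro _; exact hσ0.ge
          | succ i ih => intro hi; exact (ih (by omega)).trans (hσ_mono i (by omega)).le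
        exact this j (by omega)
      have ih' := ih (by omega) ⟨haj, hm.le.trans hb.2⟩
      have hstep : ∀ x, σ j ≤ x → x < t → ϖ x t ≤ L := by
        intro x hx hxt
        have e1 := hϖ_super (σ j) x t haj hx hxt.le (h3.trans hb.2)
        have e2 := hϖ_super (σ j) t (σ (j + 1)) haj (by linarith) h3 hb.2
        have e3 := hϖ_nonneg (σ j) x haj hx (by linarith [hb.2])
        have e4 := hϖ_nonneg t (σ (j + 1)) (by linarith) h3 hb.2
        have e5 := hσ_L j (by omega)
        linarith
      rcases le_or_gt t (σ j) with h | h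
      · obtain ⟨k, hk, S, hS⟩ := ih' s t h1 h2 h
        exact ⟨k, by omega, S, hS⟩
      · rcases le_or_gt (σ j) s with h' | h'
        · exact ⟨0 + 1, by omega, _, (AdmChain.nil s).snoc h2 (hstep s h' h2)⟩
        · obtain ⟨k, hk, S, hS⟩ := ih' s (σ j) h1 h' le_rfl
          exact ⟨k + 1, by omega, _, hS.snoc h (hstep _ le_rfl h)⟩
  intro n τ h0 hn hm
  have hmono : ∀ i j, i ≤ j → j ≤ n → τ i ≤ τ j := by
    intro i j hij
    induction j, hij using Nat.le_induction with
    | base => intro _; exact le_rfl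
    | succ j hj ih => intro h; exact (ih (by omega)).trans (hm j (by omega)).le
  have main : ∀ m ≤ n, ∃ k S, AdmChain p L f ϖ k a (τ m) S ∧
      ∑ i ∈ Finset.range m, ‖f (τ (i + 1)) - f (τ i)‖ ^ p ≤ (J + 1 : ℝ) ^ (p - 1) * S := by
    intro m
    induction m with
    | zero => intro _; exact ⟨0, 0, h0 ▸ AdmChain.nil _, by simp⟩
    | succ m ih =>
      intro hmn
      obtain ⟨k, S, hS, hle⟩ := ih (by omega)
      obtain ⟨l, hl, T, hT⟩ := key J le_rfl (by rw [hσJ]; exact ⟨hab, le_rfl⟩) (τ m) (τ (m + 1))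
        (h0 ▸ hmono 0 m (by omega) (by omega)) (hm m (by omega))
        (by rw [hσJ, ← hn]; exact hmono _ _ hmn le_rfl)
      refine ⟨_, _, hS.trans hT, ?_⟩
      rw [Finset.sum_range_succ, mul_add]
      obtain ⟨hT0, hb⟩ := hT.bound hp
      refine add_le_add hle (hb.trans (mul_le_mul_of_nonneg_right ?_ hT0))
      refine Real.rpow_le_rpow (by positivity) ?_ (by linarith)
      have : (l : ℝ) ≤ J := by exact_mod_cast hl
      linarith
  obtain ⟨k, S, hS, hle⟩ := main n le_rfl
  obtain ⟨u, hu0, huk, hum, hul, hus⟩ := hS.exists_fun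
  have := hf k u hu0 (huk.trans hn) hum hul
  rw [hus] at this
  exact hle.trans (mul_le_mul_of_nonneg_left this (by positivity))
end

section
/- (Sewing lemma, local version.) Let E be a Banach space, I = [a,b] a compact interval, ζ ∈ (0,1), ω and ϖ controls on I, and L > 0. Let h : Δ_I → E be continuous and satisfy |δh(s,u,t)|_E ≤ ω(s,t)^{1/ζ} for all (s,u,t) ∈ Δ_I^{(2)} with ϖ(s,t) ≤ L. Then there exists a unique path 𝓘h : I → E with 𝓘h(a) = 0 such that the two-index map Λh(s,t) := h(s,t) − (𝓘h(t) − 𝓘h(s)) admits a control ω̃ with |Λh(s,t)|_E ≤ ω̃(s,t)^{1/ζ} for all (s,t) ∈ Δ_I with ϖ(s,t) ≤ L. Moreover, there exists a universal constant C_ζ > 0 depending only on ζ such that |Λh(s,t)|_E ≤ C_ζ ω(s,t)^{1/ζ} for all (s,t) ∈ Δ_I with ϖ(s,t) ≤ L. -/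
/-- `ω` is a control on the interval `[a,b]`: nonnegative and superadditive on the simplex,
continuous, and vanishing on the diagonal. -/
def IsControl (a b : ℝ) (ω : ℝ → ℝ → ℝ) : Prop :=
  (∀ s t, a ≤ s → s ≤ t → t ≤ b → 0 ≤ ω s t) ∧
  (∀ s θ t, a ≤ s → s ≤ θ → θ ≤ t → t ≤ b → ω s θ + ω θ t ≤ ω s t) ∧
  ContinuousOn (fun q : ℝ × ℝ => ω q.1 q.2)
    {q : ℝ × ℝ | a ≤ q.1 ∧ q.1 ≤ q.2 ∧ q.2 ≤ b} ∧
  (∀ s, a ≤ s → s ≤ b → ω s s = 0)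

/-- Superadditivity implies monotonicity. -/
lemma IsControl.mono {a b : ℝ} {ω : ℝ → ℝ → ℝ} (hω : IsControl a b ω) {s s' t' t : ℝ}
    (h1 : a ≤ s) (h2 : s ≤ s') (h3 : s' ≤ t') (h4 : t' ≤ t) (h5 : t ≤ b) :
    ω s' t' ≤ ω s t := by
  obtain ⟨hp, hs, -, -⟩ := hω
  have e1 := hs s s' t h1 h2 (h3.trans h4) h5
  have e2 := hs s' t' t (h1.trans h2) h3 h4 h5
  have e3 := hp s s' h1 h2 (by linarith)
  have e4 := hp t' t (by linarith) h4 h5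
  linarith

/-- A control is uniformly small near the diagonal. -/
lemma IsControl.small {a b : ℝ} {ω : ℝ → ℝ → ℝ} (hω : IsControl a b ω) {ε : ℝ} (hε : 0 < ε) :
    ∃ d > 0, ∀ s t, a ≤ s → s ≤ t → t ≤ b → t - s < d → ω s t ≤ ε := by
  obtain ⟨hp, hs, hc, h0⟩ := hω
  have hK : IsCompact {q : ℝ × ℝ | a ≤ q.1 ∧ q.1 ≤ q.2 ∧ q.2 ≤ b} := by
    apply IsCompact.of_isClosed_subset (isCompact_Icc (a := ((a, a) : ℝ × ℝ)) (b := (b, b)))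
    · apply IsClosed.inter
      · exact isClosed_le continuous_const continuous_fst
      apply IsClosed.inter
      · exact isClosed_le continuous_fst continuous_snd
      · exact isClosed_le continuous_snd continuous_const
    · rintro ⟨x, y⟩ ⟨h1, h2, h3⟩
      simp only at h1 h2 h3
      exact ⟨⟨h1, h1.trans h2⟩, ⟨h2.trans h3, h3⟩⟩
  have hu := hK.uniformContinuousOn_of_continuous hc
  rw [Metric.uniformContinuousOn_iff] at hu
  obtain ⟨d, hd, H⟩ := hu ε hε
  refine ⟨d, hd, fun s t h1 h2 h3 h4 => ?_⟩
  have := H (s, t) ⟨h1, h2, h3⟩ (s, s) ⟨h1, le_refl _, h2.trans h3⟩ (by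
    rw [Prod.dist_eq]
    simp only [dist_self, Real.dist_eq]
    rw [abs_of_nonneg (by linarith)]
    exact max_lt hd h4)
  simp only [Real.dist_eq, h0 s h1 (h2.trans h3), sub_zero] at this
  exact (le_abs_self _).trans this.le

/-- Uniform partition points, stopped at `t`. -/
noncomputable def sewPt (a b : ℝ) (m : ℕ) (t : ℝ) (i : ℕ) : ℝ :=
  min t (a + i * ((b - a) / (m + 1)))

lemma sewPt_mono {a b : ℝ} (hab : a ≤ b) (m : ℕ) (t : ℝ) : Monotone (sewPt a b m t) := by
  intro i j hij
  unfold sewPt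
  have : 0 ≤ (b - a) / (m + 1 : ℝ) := div_nonneg (by linarith) (by positivity)
  have : (i : ℝ) ≤ j := by exact_mod_cast hij
  gcongr

lemma sewPt_zero {a b : ℝ} (m : ℕ) {t : ℝ} (ht : a ≤ t) : sewPt a b m t 0 = a := by
  simp [sewPt, ht]

lemma sewPt_last {a b : ℝ} (m : ℕ) {t : ℝ} (ht : t ≤ b) : sewPt a b m t (m + 1) = t := by
  unfold sewPt
  apply min_eq_left
  have : ((m : ℝ) + 1) ≠ 0 := by positivity
  push_cast
  rw [mul_div_cancel₀ _ this]
  linarith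

lemma sewPt_le {a b : ℝ} (m : ℕ) (t : ℝ) (i : ℕ) : sewPt a b m t i ≤ t := min_le_left _ _

lemma le_sewPt {a b : ℝ} (hab : a ≤ b) (m : ℕ) {t : ℝ} (ht : a ≤ t) (i : ℕ) :
    a ≤ sewPt a b m t i := by
  have := sewPt_mono hab m t (Nat.zero_le i)
  rwa [sewPt_zero m ht] at this

lemma sewPt_sub {a b : ℝ} (hab : a ≤ b) (m : ℕ) (t : ℝ) (i : ℕ) :
    sewPt a b m t (i + 1) - sewPt a b m t i ≤ (b - a) / (m + 1) := by
  unfold sewPt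
  have : 0 ≤ (b - a) / (m + 1 : ℝ) := div_nonneg (by linarith) (by positivity)
  push_cast
  rcases le_total t (a + i * ((b - a) / (m + 1))) with h | h
  · rw [min_eq_left h]
    have := min_le_left t (a + (i + 1) * ((b - a) / (m + 1)))
    linarith
  · rw [min_eq_right h]
    have := min_le_right t (a + (i + 1) * ((b - a) / (m + 1)))
    linarith

/-- Controls on partitions sum up to at most the total. -/
lemma IsControl.sum_le {a b : ℝ} {ω : ℝ → ℝ → ℝ} (hω : IsControl a b ω) {p : ℕ → ℝ}
    (hp : Monotone p) (h0 : a ≤ p 0) (hb : ∀ i, p i ≤ b) (n : ℕ) :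
    ∑ i ∈ Finset.range n, ω (p i) (p (i + 1)) ≤ ω (p 0) (p n) := by
  induction n with
  | zero => simp [hω.2.2.2 (p 0) h0 (hb 0)]
  | succ n ih =>
    rw [Finset.sum_range_succ]
    have := hω.2.1 (p 0) (p n) (p (n + 1)) h0 (hp (Nat.zero_le _)) (hp (Nat.le_succ _)) (hb _)
    linarith

lemma sew_fine {a b : ℝ} (hab : a ≤ b) {ω : ℝ → ℝ → ℝ} (hω : IsControl a b ω)
    {ε : ℝ} (hε : 0 < ε) :
    ∃ N : ℕ, ∀ m ≥ N, ∀ t, a ≤ t → t ≤ b → ∀ i,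
      ω (sewPt a b m t i) (sewPt a b m t (i + 1)) ≤ ε := by
  obtain ⟨d, hd, H⟩ := hω.small hε
  obtain ⟨N, hN⟩ := exists_nat_gt ((b - a) / d)
  refine ⟨N, fun m hm t h1 h2 i => ?_⟩
  apply H _ _ (le_sewPt hab m h1 i) (sewPt_mono hab m t (Nat.le_succ i))
    ((sewPt_le m t _).trans h2)
  refine (sewPt_sub hab m t i).trans_lt ?_
  have : (N : ℝ) ≤ m := by exact_mod_cast hm
  rw [div_lt_iff₀ hd] at hN
  rw [div_lt_iff₀ (by positivity)]
  nlinarith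

lemma sew_mesh {a b : ℝ} (hab : a ≤ b) {ω ϖ : ℝ → ℝ → ℝ} (hω : IsControl a b ω)
    (hϖ : IsControl a b ϖ) {L : ℝ} (hL : 0 < L) {θ : ℝ} (hθ : 1 < θ) {ε : ℝ} (hε : 0 < ε) :
    ∃ N : ℕ, ∀ m ≥ N, ∀ t, a ≤ t → t ≤ b →
      (∀ i, ϖ (sewPt a b m t i) (sewPt a b m t (i + 1)) ≤ L) ∧
      ∑ i ∈ Finset.range (m + 1), ω (sewPt a b m t i) (sewPt a b m t (i + 1)) ^ θ ≤ ε := by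
  have hW : 0 ≤ ω a b := hω.1 a b le_rfl hab le_rfl
  obtain ⟨N1, h1⟩ := sew_fine hab hϖ hL
  obtain ⟨e, he, hee⟩ : ∃ e : ℝ, 0 < e ∧ e ^ (θ - 1) * ω a b ≤ ε := by
    refine ⟨(ε / (ω a b + 1)) ^ (1 / (θ - 1)), by positivity, ?_⟩
    rw [← Real.rpow_mul (by positivity), one_div_mul_cancel (by linarith), Real.rpow_one,
      div_mul_eq_mul_div, div_le_iff₀ (by positivity)]
    nlinarith
  obtain ⟨N2, h2⟩ := sew_fine hab hω he
  refine ⟨max N1 N2, fun m hm t ha hb => ⟨h1 m (le_trans (le_max_left _ _) hm) t ha hb, ?_⟩⟩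
  have h2' := h2 m (le_trans (le_max_right _ _) hm) t ha hb
  have hpm := sewPt_mono hab m t
  have hpb : ∀ i, sewPt a b m t i ≤ b := fun i => (sewPt_le m t i).trans hb
  calc _ ≤ ∑ i ∈ Finset.range (m + 1),
        e ^ (θ - 1) * ω (sewPt a b m t i) (sewPt a b m t (i + 1)) := by
        apply Finset.sum_le_sum
        intro i _
        have h0 : 0 ≤ ω (sewPt a b m t i) (sewPt a b m t (i + 1)) :=
          hω.1 _ _ (le_sewPt hab m ha i) (hpm (Nat.le_succ i)) (hpb _)
        rcases h0.eq_or_lt with h | h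
        · rw [← h, Real.zero_rpow (by linarith)]; simp
        · have : ω (sewPt a b m t i) (sewPt a b m t (i + 1)) ^ θ =
            ω (sewPt a b m t i) (sewPt a b m t (i + 1)) ^ (θ - 1) *
              ω (sewPt a b m t i) (sewPt a b m t (i + 1)) := by
            conv_rhs => rw [← Real.rpow_add_one h.ne']
            simp
          rw [this]
          gcongr
          exact h2' i
    _ ≤ e ^ (θ - 1) * ω a b := by
        rw [← Finset.mul_sum]
        gcongr
        refine (hω.sum_le hpm (le_sewPt hab m ha 0) hpb _).trans ?_
        exact hω.mono le_rfl (le_sewPt hab m ha 0) (hpm (Nat.zero_le _)) (hpb _) le_rfl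
    _ ≤ ε := hee

section
variable {E : Type} [NormedAddCommGroup E]

/-- Partition estimate (Feyel–de La Pradelle splitting). -/
lemma sew_partition {a b : ℝ} {ω ϖ : ℝ → ℝ → ℝ} (hω : IsControl a b ω)
    (hϖ : IsControl a b ϖ) {L : ℝ} {θ : ℝ} (hθ : 1 < θ) {h : ℝ → ℝ → E}
    (hd : ∀ s u t, a ≤ s → s ≤ u → u ≤ t → t ≤ b → ϖ s t ≤ L →
          ‖h s t - h s u - h u t‖ ≤ ω s t ^ θ)
    (h0 : ∀ s, a ≤ s → s ≤ b → h s s = 0)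
    {C : ℝ} (hC : 0 ≤ C) (hC2 : 2 + 2 * C * (1 / 2) ^ θ ≤ C)
    {p : ℕ → ℝ} (hp : Monotone p) (hpa : ∀ i, a ≤ p i) (hpb : ∀ i, p i ≤ b) (n : ℕ) :
    ∀ i j, i ≤ j → j - i ≤ n → ϖ (p i) (p j) ≤ L →
      ‖h (p i) (p j) - ∑ k ∈ Finset.Ico i j, h (p k) (p (k + 1))‖ ≤ C * ω (p i) (p j) ^ θ := by
  have hnn : ∀ i j, i ≤ j → 0 ≤ ω (p i) (p j) := fun i j hij =>
    hω.1 _ _ (hpa i) (hp hij) (hpb j)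
  induction n with
  | zero =>
    intro i j hij hn _
    obtain rfl : i = j := by omega
    have := hnn i i le_rfl
    simp only [h0 _ (hpa i) (hpb i), Finset.Ico_self, Finset.sum_empty, sub_zero, norm_zero]
    positivity
  | succ n ih =>
    intro i j hij hn hL
    rcases hij.eq_or_lt with rfl | hlt
    · exact ih i i le_rfl (by omega) hL
    obtain ⟨k, hik, hkj, hk1, hk2⟩ : ∃ k, i ≤ k ∧ k < j ∧ ω (p i) (p k) ≤ ω (p i) (p j) / 2 ∧
        ω (p (k + 1)) (p j) ≤ ω (p i) (p j) / 2 := by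
      by_contra! hcon
      have key : ∀ r, i + r < j → ω (p i) (p (i + r)) ≤ ω (p i) (p j) / 2 := by
        intro r
        induction r with
        | zero =>
          intro _
          rw [Nat.add_zero, hω.2.2.2 _ (hpa i) (hpb i)]
          have := hnn i j hij
          linarith
        | succ r ihr =>
          intro hr
          have h1 := hcon (i + r) (by omega) (by omega) (ihr (by omega))
          have h2 := hω.2.1 (p i) (p (i + r + 1)) (p j) (hpa i) (hp (by omega)) (hp (by omega))
            (hpb j)
          rw [← Nat.add_assoc]
          linarith
      have h1 := hcon (j - 1) (by omega) (by omega) (by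
        have := key (j - 1 - i) (by omega)
        rwa [show i + (j - 1 - i) = j - 1 by omega] at this)
      rw [show j - 1 + 1 = j by omega, hω.2.2.2 _ (hpa j) (hpb j)] at h1
      have := hnn i j hij
      linarith
    have m1 : p i ≤ p k := hp hik
    have m2 : p k ≤ p (k + 1) := hp (Nat.le_succ k)
    have m3 : p (k + 1) ≤ p j := hp hkj
    have L1 : ϖ (p i) (p k) ≤ L :=
      (hϖ.mono (hpa i) le_rfl m1 (m2.trans m3) (hpb j)).trans hL
    have L2 : ϖ (p (k + 1)) (p j) ≤ L :=
      (hϖ.mono (hpa i) (m1.trans m2) m3 le_rfl (hpb j)).trans hL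
    have L3 : ϖ (p k) (p j) ≤ L :=
      (hϖ.mono (hpa i) m1 (m2.trans m3) le_rfl (hpb j)).trans hL
    have I1 := ih i k hik (by omega) L1
    have I2 := ih (k + 1) j hkj (by omega) L2
    have D1 := hd (p i) (p k) (p j) (hpa i) m1 (m2.trans m3) (hpb j) hL
    have D2 := hd (p k) (p (k + 1)) (p j) (hpa k) m2 m3 (hpb j) L3
    have W0 := hnn i j hij
    have D2' : ω (p k) (p j) ^ θ ≤ ω (p i) (p j) ^ θ := by
      apply Real.rpow_le_rpow (hnn k j hkj.le) _ (by linarith)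
      exact hω.mono (hpa i) m1 (m2.trans m3) le_rfl (hpb j)
    have half : (ω (p i) (p j) / 2) ^ θ = (1 / 2) ^ θ * ω (p i) (p j) ^ θ := by
      rw [← Real.mul_rpow (by norm_num) W0]; congr 1; ring
    have I1' : C * ω (p i) (p k) ^ θ ≤ C * ((1 / 2) ^ θ * ω (p i) (p j) ^ θ) := by
      rw [← half]
      exact mul_le_mul_of_nonneg_left
        (Real.rpow_le_rpow (hnn i k hik) hk1 (by linarith)) hC
    have I2' : C * ω (p (k + 1)) (p j) ^ θ ≤ C * ((1 / 2) ^ θ * ω (p i) (p j) ^ θ) := by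
      rw [← half]
      exact mul_le_mul_of_nonneg_left
        (Real.rpow_le_rpow (hnn (k + 1) j hkj) hk2 (by linarith)) hC
    have split : h (p i) (p j) - ∑ k ∈ Finset.Ico i j, h (p k) (p (k + 1)) =
        (h (p i) (p j) - h (p i) (p k) - h (p k) (p j)) +
        (h (p k) (p j) - h (p k) (p (k + 1)) - h (p (k + 1)) (p j)) +
        (h (p i) (p k) - ∑ k ∈ Finset.Ico i k, h (p k) (p (k + 1))) +
        (h (p (k + 1)) (p j) - ∑ k ∈ Finset.Ico (k + 1) j, h (p k) (p (k + 1))) := by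
      rw [← Finset.sum_Ico_consecutive _ hik hkj.le, Finset.sum_eq_sum_Ico_succ_bot hkj]
      abel
    rw [split]
    refine (norm_add₄_le).trans ?_
    have Wt : 0 ≤ ω (p i) (p j) ^ θ := by positivity
    have := mul_le_mul_of_nonneg_right hC2 Wt
    nlinarith

/-- Riemann sums. -/
noncomputable def sewSum (h : ℝ → ℝ → E) (a b : ℝ) (m : ℕ) (t : ℝ) : E :=
  ∑ i ∈ Finset.range (m + 1), h (sewPt a b m t i) (sewPt a b m t (i + 1))

lemma sewPt_min {a b : ℝ} (m : ℕ) {s t : ℝ} (hst : s ≤ t) (i : ℕ) :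
    sewPt a b m s i = min s (sewPt a b m t i) := by
  unfold sewPt
  rw [← min_assoc, min_eq_left hst]

/-- Approximate additivity of the Riemann sums. -/
lemma sewSum_sub {a b : ℝ} (hab : a ≤ b) {ω ϖ : ℝ → ℝ → ℝ} (hω : IsControl a b ω)
    (hϖ : IsControl a b ϖ) {L : ℝ} {θ : ℝ} (hθ : 1 < θ) {h : ℝ → ℝ → E}
    (hd : ∀ s u t, a ≤ s → s ≤ u → u ≤ t → t ≤ b → ϖ s t ≤ L →
          ‖h s t - h s u - h u t‖ ≤ ω s t ^ θ)
    (h0 : ∀ s, a ≤ s → s ≤ b → h s s = 0)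
    {C : ℝ} (hC : 0 ≤ C) (hC2 : 2 + 2 * C * (1 / 2) ^ θ ≤ C) (m : ℕ) {s t : ℝ}
    (has : a ≤ s) (hst : s ≤ t) (htb : t ≤ b) (hL : ϖ s t ≤ L)
    (hm : ∀ i, ϖ (sewPt a b m t i) (sewPt a b m t (i + 1)) ≤ L) :
    ‖h s t - (sewSum h a b m t - sewSum h a b m s)‖ ≤ C * ω s t ^ θ +
      ∑ i ∈ Finset.range (m + 1), ω (sewPt a b m t i) (sewPt a b m t (i + 1)) ^ θ := by
  have hat := has.trans hst
  set p := sewPt a b m t with hpdef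
  have hp : Monotone p := sewPt_mono hab m t
  have hpa : ∀ i, a ≤ p i := le_sewPt hab m hat
  have hpt : ∀ i, p i ≤ t := sewPt_le m t
  have hpb : ∀ i, p i ≤ b := fun i => (hpt i).trans htb
  have hp0 : p 0 = a := sewPt_zero m hat
  have hpl : p (m + 1) = t := sewPt_last m htb
  have A := sew_partition hω hϖ hθ hd h0 hC hC2 (p := fun i => max s (p i))
    (fun i j hij => max_le_max le_rfl (hp hij)) (fun i => has.trans (le_max_left _ _))
    (fun i => max_le (hst.trans htb) (hpb i)) (m + 1) 0 (m + 1) (Nat.zero_le _) (by simp)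
    (by simpa [hp0, hpl, has, hst] using hL)
  simp only [hp0, hpl, max_eq_left has, max_eq_right hst, ← Finset.range_eq_Ico] at A
  have B : ‖∑ i ∈ Finset.range (m + 1), (h (p i) (p (i + 1)) -
      h (min s (p i)) (min s (p (i + 1))) - h (max s (p i)) (max s (p (i + 1))))‖ ≤
      ∑ i ∈ Finset.range (m + 1), ω (p i) (p (i + 1)) ^ θ := by
    apply norm_sum_le_of_le
    intro i _
    have hii := hp (Nat.le_succ i)
    have hn : 0 ≤ ω (p i) (p (i + 1)) := hω.1 _ _ (hpa i) hii (hpb _)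
    have hss := h0 s has (hst.trans htb)
    rcases le_total s (p i) with c | c
    · rw [min_eq_left c, min_eq_left (c.trans hii), max_eq_right c, max_eq_right (c.trans hii),
        hss, sub_zero, sub_self, norm_zero]
      positivity
    rcases le_total (p (i + 1)) s with c' | c'
    · rw [min_eq_right c, min_eq_right c', max_eq_left c, max_eq_left c',
        hss, sub_zero, sub_self, norm_zero]
      positivity
    · rw [min_eq_right c, min_eq_left c', max_eq_left c, max_eq_right c']
      exact hd _ _ _ (hpa i) c c' (hpb _) (hm i)
  have e : h s t - (sewSum h a b m t - sewSum h a b m s) =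
      (h s t - ∑ k ∈ Finset.range (m + 1), h (max s (p k)) (max s (p (k + 1)))) -
      ∑ i ∈ Finset.range (m + 1), (h (p i) (p (i + 1)) -
      h (min s (p i)) (min s (p (i + 1))) - h (max s (p i)) (max s (p (i + 1)))) := by
    simp only [sewSum, sewPt_min m hst, Finset.sum_sub_distrib, ← hpdef]
    abel
  rw [e]
  exact (norm_sub_le _ _).trans (add_le_add A B)

/-- Telescoping. -/
lemma sew_tele {a b : ℝ} (h : ℝ → ℝ → E) (J : ℝ → E) (m : ℕ) {t : ℝ}
    (hat : a ≤ t) (htb : t ≤ b) (hJ : J a = 0) :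
    sewSum h a b m t - J t = ∑ i ∈ Finset.range (m + 1),
      (h (sewPt a b m t i) (sewPt a b m t (i + 1)) -
        (J (sewPt a b m t (i + 1)) - J (sewPt a b m t i))) := by
  rw [Finset.sum_sub_distrib, Finset.sum_range_sub (fun i => J (sewPt a b m t i)),
    sewPt_last m htb, sewPt_zero m hat, hJ, sub_zero, sewSum]

/-- Any admissible path is the limit of Riemann sums. -/
lemma sew_tendsto {a b : ℝ} (hab : a ≤ b) {ω ϖ : ℝ → ℝ → ℝ} (hω : IsControl a b ω)
    (hϖ : IsControl a b ϖ) {L : ℝ} (hL : 0 < L) {θ : ℝ} (hθ : 1 < θ) {h : ℝ → ℝ → E}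
    (J : ℝ → E) (hJ : J a = 0)
    (hb : ∀ s t, a ≤ s → s ≤ t → t ≤ b → ϖ s t ≤ L → ‖h s t - (J t - J s)‖ ≤ ω s t ^ θ)
    {t : ℝ} (hat : a ≤ t) (htb : t ≤ b) :
    Filter.Tendsto (fun m => sewSum h a b m t) Filter.atTop (nhds (J t)) := by
  rw [Metric.tendsto_atTop]
  intro ε hε
  obtain ⟨N, hN⟩ := sew_mesh hab hω hϖ hL hθ (half_pos hε)
  refine ⟨N, fun m hm => ?_⟩
  obtain ⟨h1, h2⟩ := hN m hm t hat htb
  rw [dist_eq_norm, sew_tele h J m hat htb hJ]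
  refine (norm_sum_le_of_le _ fun i _ => hb _ _ (le_sewPt hab m hat i)
    (sewPt_mono hab m t (Nat.le_succ i)) ((sewPt_le m t _).trans htb) (h1 i)).trans_lt ?_
  linarith

lemma sewSum_left {a b : ℝ} (hab : a ≤ b) {h : ℝ → ℝ → E} (h0 : h a a = 0) (m : ℕ) :
    sewSum h a b m a = 0 := by
  apply Finset.sum_eq_zero
  intro i _
  have : ∀ j, sewPt a b m a j = a := fun j =>
    le_antisymm (sewPt_le m a j) (le_sewPt hab m le_rfl j)
  rw [this, this, h0]

lemma sew_cauchy {a b : ℝ} (hab : a ≤ b) {ω ϖ : ℝ → ℝ → ℝ} (hω : IsControl a b ω)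
    (hϖ : IsControl a b ϖ) {L : ℝ} (hL : 0 < L) {θ : ℝ} (hθ : 1 < θ) {h : ℝ → ℝ → E}
    (hd : ∀ s u t, a ≤ s → s ≤ u → u ≤ t → t ≤ b → ϖ s t ≤ L →
          ‖h s t - h s u - h u t‖ ≤ ω s t ^ θ)
    (h0 : ∀ s, a ≤ s → s ≤ b → h s s = 0)
    {C : ℝ} (hC : 0 < C) (hC2 : 2 + 2 * C * (1 / 2) ^ θ ≤ C) {t : ℝ}
    (hat : a ≤ t) (htb : t ≤ b) : CauchySeq (fun m => sewSum h a b m t) := by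
  rw [Metric.cauchySeq_iff']
  intro ε hε
  obtain ⟨N, hN⟩ := sew_mesh hab hω hϖ hL hθ (show 0 < ε / 6 / C by positivity)
  obtain ⟨hN1, hN2⟩ := hN N le_rfl t hat htb
  obtain ⟨M, hM⟩ := sew_mesh hab hω hϖ hL hθ (show 0 < ε / 6 / (N + 1 : ℝ) by positivity)
  have key : ∀ m ≥ M, dist (sewSum h a b N t) (sewSum h a b m t) ≤ ε / 3 := by
    intro m hm
    rw [dist_eq_norm, sew_tele h (sewSum h a b m) N hat htb
      (sewSum_left hab (h0 a le_rfl hab) m)]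
    have : ∀ i ∈ Finset.range (N + 1), ‖h (sewPt a b N t i) (sewPt a b N t (i + 1)) -
        (sewSum h a b m (sewPt a b N t (i + 1)) - sewSum h a b m (sewPt a b N t i))‖ ≤
        C * ω (sewPt a b N t i) (sewPt a b N t (i + 1)) ^ θ + ε / 6 / (N + 1 : ℝ) := by
      intro i _
      have u1 := le_sewPt hab N hat i
      have u2 := sewPt_mono hab N t (Nat.le_succ i)
      have u3 := (sewPt_le (a := a) (b := b) N t (i + 1)).trans htb
      obtain ⟨v1, v2⟩ := hM m hm _ (u1.trans u2) u3
      have := sewSum_sub hab hω hϖ hθ hd h0 hC.le hC2 m u1 u2 u3 (hN1 i) v1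
      exact this.trans (by gcongr)
    refine (norm_sum_le_of_le _ this).trans ?_
    rw [Finset.sum_add_distrib, ← Finset.mul_sum, Finset.sum_const, Finset.card_range,
      nsmul_eq_mul]
    push_cast
    rw [mul_div_cancel₀ _ (by positivity)]
    rw [le_div_iff₀ hC] at hN2
    linarith
  refine ⟨M, fun n hn => ?_⟩
  have h1 := key n hn
  have h2 := key M le_rfl
  have h3 := dist_triangle_left (sewSum h a b n t) (sewSum h a b M t) (sewSum h a b N t)
  linarith

end

/-- The sewing lemma, local version: there is a universal constant `C_ζ > 0`, depending only
on `ζ ∈ (0,1)`, such that for every Banach space `E`, every pair of controls `ω, ϖ` on `[a,b]`,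
every `L > 0` and every continuous two-index map `h : Δ_{[a,b]} → E` with
`‖δh(s,u,t)‖ ≤ ω(s,t)^(1/ζ)` whenever `ϖ(s,t) ≤ L`, there exists a unique path `𝓘h` on `[a,b]`
with `𝓘h(a) = 0` such that `Λh := h - δ𝓘h` admits a control `ω̃` with
`‖Λh(s,t)‖ ≤ ω̃(s,t)^(1/ζ)` on `{ϖ ≤ L}`; moreover `‖Λh(s,t)‖ ≤ C_ζ ω(s,t)^(1/ζ)` there. -/
theorem sewing_lemma_local
    (ζ : ℝ) (hζ : ζ ∈ Set.Ioo (0 : ℝ) 1) :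
    ∃ C : ℝ, 0 < C ∧
      ∀ (E : Type) [NormedAddCommGroup E] [NormedSpace ℝ E] [CompleteSpace E],
      ∀ (a b : ℝ), a ≤ b →
      ∀ (ω ϖ : ℝ → ℝ → ℝ), IsControl a b ω → IsControl a b ϖ →
      ∀ (L : ℝ), 0 < L →
      ∀ (h : ℝ → ℝ → E),
        ContinuousOn (fun q : ℝ × ℝ => h q.1 q.2)
          {q : ℝ × ℝ | a ≤ q.1 ∧ q.1 ≤ q.2 ∧ q.2 ≤ b} →
        (∀ s u t, a ≤ s → s ≤ u → u ≤ t → t ≤ b → ϖ s t ≤ L →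
          ‖h s t - h s u - h u t‖ ≤ ω s t ^ (1 / ζ)) →
        ∃ I : ℝ → E,
          (I a = 0 ∧
            ∃ ω' : ℝ → ℝ → ℝ, IsControl a b ω' ∧
              ∀ s t, a ≤ s → s ≤ t → t ≤ b → ϖ s t ≤ L →
                ‖h s t - (I t - I s)‖ ≤ ω' s t ^ (1 / ζ)) ∧
          (∀ I' : ℝ → E,
            (I' a = 0 ∧
              ∃ ω' : ℝ → ℝ → ℝ, IsControl a b ω' ∧
                ∀ s t, a ≤ s → s ≤ t → t ≤ b → ϖ s t ≤ L →
                  ‖h s t - (I' t - I' s)‖ ≤ ω' s t ^ (1 / ζ)) →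
            Set.EqOn I' I (Set.Icc a b)) ∧
          (∀ s t, a ≤ s → s ≤ t → t ≤ b → ϖ s t ≤ L →
            ‖h s t - (I t - I s)‖ ≤ C * ω s t ^ (1 / ζ)) := by
  obtain ⟨hz0, hz1⟩ := hζ
  have hθ : 1 < 1 / ζ := by rw [lt_div_iff₀ hz0]; linarith
  generalize hθd : 1 / ζ = θ at hθ
  have hr : (1 / 2 : ℝ) ^ θ < 1 / 2 := by
    have := Real.rpow_lt_rpow_of_exponent_gt (x := (1 / 2 : ℝ)) (by norm_num) (by norm_num) hθ
    simpa using this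
  set r : ℝ := (1 / 2 : ℝ) ^ θ with hrd
  have hpos : 0 < 1 - 2 * r := by linarith
  have hC : 0 < 2 / (1 - 2 * r) := by positivity
  have hC2 : 2 + 2 * (2 / (1 - 2 * r)) * r ≤ 2 / (1 - 2 * r) := by
    apply le_of_eq
    field_simp
    ring
  generalize 2 / (1 - 2 * r) = C at hC hC2
  refine ⟨C, hC, ?_⟩
  intro E _ _ _ a b hab ω ϖ hω hϖ L hL h hcont hd
  have h0 : ∀ s, a ≤ s → s ≤ b → h s s = 0 := by
    intro s h1 h2
    have := hd s s s h1 le_rfl le_rfl h2 (by rw [hϖ.2.2.2 s h1 h2]; exact hL.le)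
    rw [hω.2.2.2 s h1 h2, Real.zero_rpow (by linarith)] at this
    simpa using this
  have hex : ∀ t, ∃ x : E, a ≤ t → t ≤ b →
      Filter.Tendsto (fun m => sewSum h a b m t) Filter.atTop (nhds x) := by
    intro t
    by_cases ht : a ≤ t ∧ t ≤ b
    · obtain ⟨x, hx⟩ := cauchySeq_tendsto_of_complete
        (sew_cauchy hab hω hϖ hL hθ hd h0 hC hC2 ht.1 ht.2)
      exact ⟨x, fun _ _ => hx⟩
    · exact ⟨0, fun h1 h2 => absurd ⟨h1, h2⟩ ht⟩
  choose I hI using hex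
  have hIa : I a = 0 := by
    have h1 := hI a le_rfl hab
    simp only [sewSum_left hab (h0 a le_rfl hab)] at h1
    exact tendsto_nhds_unique h1 tendsto_const_nhds
  have hbound : ∀ s t, a ≤ s → s ≤ t → t ≤ b → ϖ s t ≤ L →
      ‖h s t - (I t - I s)‖ ≤ C * ω s t ^ θ := by
    intro s t h1 h2 h3 h4
    apply le_of_forall_pos_le_add
    intro ε hε
    have T := (((hI t (h1.trans h2) h3).sub (hI s h1 (h2.trans h3))).const_sub (h s t)).norm
    refine le_of_tendsto T ?_
    obtain ⟨N, hN⟩ := sew_mesh hab hω hϖ hL hθ hε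
    filter_upwards [Filter.eventually_ge_atTop N] with m hm
    obtain ⟨v1, v2⟩ := hN m hm t (h1.trans h2) h3
    exact (sewSum_sub hab hω hϖ hθ hd h0 hC.le hC2 m h1 h2 h3 h4 v1).trans (by gcongr)
  refine ⟨I, ⟨hIa, fun s t => C ^ ζ * ω s t, ?_, ?_⟩, ?_, hbound⟩
  · have hCz : 0 < C ^ ζ := by positivity
    refine ⟨fun s t h1 h2 h3 => mul_nonneg hCz.le (hω.1 s t h1 h2 h3), ?_,
      continuousOn_const.mul hω.2.2.1, fun s h1 h2 => by simp [hω.2.2.2 s h1 h2]⟩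
    intro s u t h1 h2 h3 h4
    rw [← mul_add]
    exact mul_le_mul_of_nonneg_left (hω.2.1 s u t h1 h2 h3 h4) hCz.le
  · intro s t h1 h2 h3 h4
    rw [Real.mul_rpow (by positivity) (hω.1 s t h1 h2 h3), ← Real.rpow_mul hC.le, ← hθd,
      mul_one_div_cancel hz0.ne', Real.rpow_one, hθd]
    exact hbound s t h1 h2 h3 h4
  · rintro I' ⟨hI'a, ω', hω', hb'⟩ t ⟨h1, h2⟩
    exact tendsto_nhds_unique (sew_tendsto hab hω' hϖ hL hθ I' hI'a hb' h1 h2) (hI t h1 h2)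
end

section
/- Under the hypotheses of the sewing lemma (E Banach, I = [a,b], ζ ∈ (0,1), ω, ϖ controls on I, L > 0, h : Δ_I → E continuous with |δh(s,u,t)|_E ≤ ω(s,t)^{1/ζ} whenever s ≤ u ≤ t and ϖ(s,t) ≤ L), suppose additionally that p ≥ 1 and there is a control ω' with |h(s,t)|_E ≤ ω'(s,t)^{1/p} for all (s,t) ∈ Δ_I with ϖ(s,t) ≤ L. Then the sewn path 𝓘h has finite p-variation on I, i.e. sup over all finite partitions a = t_0 < ⋯ < t_n = b of Σ_i |𝓘h(t_{i+1}) − 𝓘h(t_i)|_E^p is finite. -/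
theorem control_mono {a b : ℝ} {ω : ℝ → ℝ → ℝ} (hω : IsControl a b ω) {s t : ℝ}
    (h1 : a ≤ s) (h2 : s ≤ t) (h3 : t ≤ b) : ω s t ≤ ω a b := by
  have e1 := hω.2.1 a s b le_rfl h1 (h2.trans h3) le_rfl
  have e2 := hω.2.1 s t b h1 h2 h3 le_rfl
  have e3 := hω.1 a s le_rfl h1 (h2.trans h3)
  have e4 := hω.1 t b (h1.trans h2) h3 le_rfl
  linarith

theorem control_sum {a b : ℝ} {ω : ℝ → ℝ → ℝ} (hω : IsControl a b ω) (n : ℕ) (τ : ℕ → ℝ)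
    (h0 : τ 0 = a) (hm : ∀ i j, i ≤ j → j ≤ n → τ i ≤ τ j) (hn : τ n = b) :
    ∑ i ∈ Finset.range n, ω (τ i) (τ (i + 1)) ≤ ω a b := by
  have key : ∀ k, k ≤ n → ∑ i ∈ Finset.range k, ω (τ i) (τ (i + 1)) ≤ ω a (τ k) := by
    intro k
    induction k with
    | zero =>
      intro _
      have := hm 0 n (Nat.zero_le _) le_rfl
      rw [h0, hn] at this
      simp [h0, hω.2.2.2 a le_rfl this]
    | succ k ih =>
      intro hk
      rw [Finset.sum_range_succ]
      have e := hω.2.1 a (τ k) (τ (k + 1)) le_rfl (h0 ▸ hm 0 k (Nat.zero_le _) (by omega))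
        (hm k (k + 1) (by omega) hk) (hn ▸ hm (k + 1) n hk le_rfl)
      linarith [ih (by omega)]
  simpa [hn] using key n le_rfl

theorem real_add_rpow_le {x y p : ℝ} (hx : 0 ≤ x) (hy : 0 ≤ y) (hp : 1 ≤ p) :
    (x + y) ^ p ≤ 2 ^ (p - 1) * (x ^ p + y ^ p) := by
  lift x to NNReal using hx
  lift y to NNReal using hy
  exact_mod_cast NNReal.rpow_add_le_mul_rpow_add_rpow x y hp

/-- Under the hypotheses of the sewing lemma, if in addition `‖h(s,t)‖ ≤ ω'(s,t)^(1/p)` for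
some `p ≥ 1` and a control `ω'` on `{ϖ ≤ L}`, then the sewn path `𝓘h` (i.e. any path `I` with
`I a = 0` satisfying the sewing bound `‖h(s,t) - (I t - I s)‖ ≤ C ω(s,t)^(1/ζ)` on `{ϖ ≤ L}`)
has finite `p`-variation on `[a,b]`: the partition sums `∑ ‖I(t_{i+1}) - I(t_i)‖^p` are
bounded uniformly over all finite partitions of `[a,b]`. -/
theorem sewn_path_finite_pvar
    {E : Type*} [NormedAddCommGroup E] [NormedSpace ℝ E] [CompleteSpace E]
    (a b : ℝ) (hab : a ≤ b) (ζ : ℝ) (hζ : ζ ∈ Set.Ioo (0 : ℝ) 1)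
    (ω ϖ : ℝ → ℝ → ℝ) (hω : IsControl a b ω) (hϖ : IsControl a b ϖ)
    (L : ℝ) (hL : 0 < L)
    (h : ℝ → ℝ → E)
    (hcont : ContinuousOn (fun q : ℝ × ℝ => h q.1 q.2)
      {q : ℝ × ℝ | a ≤ q.1 ∧ q.1 ≤ q.2 ∧ q.2 ≤ b})
    (hδ : ∀ s u t, a ≤ s → s ≤ u → u ≤ t → t ≤ b → ϖ s t ≤ L →
      ‖h s t - h s u - h u t‖ ≤ ω s t ^ (1 / ζ))
    (p : ℝ) (hp : 1 ≤ p)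
    (ω' : ℝ → ℝ → ℝ) (hω' : IsControl a b ω')
    (hh : ∀ s t, a ≤ s → s ≤ t → t ≤ b → ϖ s t ≤ L → ‖h s t‖ ≤ ω' s t ^ (1 / p))
    (C : ℝ) (hC : 0 < C) (I : ℝ → E) (hIa : I a = 0)
    (hI : ∀ s t, a ≤ s → s ≤ t → t ≤ b → ϖ s t ≤ L →
      ‖h s t - (I t - I s)‖ ≤ C * ω s t ^ (1 / ζ)) :
    ∃ M : ℝ, ∀ (n : ℕ) (τ : ℕ → ℝ), τ 0 = a → τ n = b → (∀ i < n, τ i < τ (i + 1)) →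
      ∑ i ∈ Finset.range n, ‖I (τ (i + 1)) - I (τ i)‖ ^ p ≤ M := by
  have hζ0 : 0 < ζ := hζ.1
  have hp0 : 0 < p := by linarith
  set B0 : ℝ := ω' a b ^ (1 / p) + C * ω a b ^ (1 / ζ) with hB0
  have small : ∀ s t, a ≤ s → s ≤ t → t ≤ b → ϖ s t ≤ L →
      ‖I t - I s‖ ≤ ω' s t ^ (1 / p) + C * ω s t ^ (1 / ζ) := by
    intro s t h1 h2 h3 h4
    have e1 := hh s t h1 h2 h3 h4
    have e2 := hI s t h1 h2 h3 h4
    have e3 : I t - I s = h s t - (h s t - (I t - I s)) := by abel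
    rw [e3]
    exact (norm_sub_le _ _).trans (add_le_add e1 e2)
  have small' : ∀ s t, a ≤ s → s ≤ t → t ≤ b → ϖ s t ≤ L → ‖I t - I s‖ ≤ B0 := by
    intro s t h1 h2 h3 h4
    refine (small s t h1 h2 h3 h4).trans ?_
    have e1 := Real.rpow_le_rpow (hω'.1 s t h1 h2 h3) (control_mono hω' h1 h2 h3)
      (show 0 ≤ 1 / p by positivity)
    have e2 := Real.rpow_le_rpow (hω.1 s t h1 h2 h3) (control_mono hω h1 h2 h3)
      (show 0 ≤ 1 / ζ by positivity)
    have e3 := mul_le_mul_of_nonneg_left e2 hC.le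
    linarith
  have bdd : ∃ B : ℝ, ∀ y ∈ Set.Icc a b, ‖I y‖ ≤ B := by
    refine IsCompact.induction_on (p := fun s => ∃ B : ℝ, ∀ y ∈ s, ‖I y‖ ≤ B)
      (isCompact_Icc (a := a) (b := b)) ⟨0, by simp⟩ ?_ ?_ ?_
    · rintro s t hst ⟨B, hB⟩
      exact ⟨B, fun y hy => hB y (hst hy)⟩
    · rintro s t ⟨B, hB⟩ ⟨B', hB'⟩
      refine ⟨max B B', ?_⟩
      rintro y (hy | hy)
      · exact (hB y hy).trans (le_max_left _ _)
      · exact (hB' y hy).trans (le_max_right _ _)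
    · intro x hx
      have hc : ContinuousOn (fun y => ϖ (min x y) (max x y)) (Set.Icc a b) := by
        have hg : ContinuousOn (fun y : ℝ => (min x y, max x y)) (Set.Icc a b) :=
          Continuous.continuousOn (by fun_prop)
        exact hϖ.2.2.1.comp hg (fun y hy =>
          ⟨le_min hx.1 hy.1, min_le_max, max_le hx.2 hy.2⟩)
      have hx0 : ϖ (min x x) (max x x) < L := by
        rw [min_self, max_self, hϖ.2.2.2 x hx.1 hx.2]; exact hL
      have ev := (hc x hx).eventually (gt_mem_nhds hx0)
      refine ⟨_, Filter.inter_mem ev self_mem_nhdsWithin, ‖I x‖ + B0, ?_⟩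
      rintro y ⟨hy, hy2⟩
      have hy : ϖ (min x y) (max x y) < L := hy
      have hd : ‖I y - I x‖ ≤ B0 := by
        rcases le_total x y with hxy | hxy
        · rw [min_eq_left hxy, max_eq_right hxy] at hy
          exact small' x y hx.1 hxy hy2.2 hy.le
        · rw [min_eq_right hxy, max_eq_left hxy] at hy
          rw [norm_sub_rev]
          exact small' y x hy2.1 hxy hx.2 hy.le
      have := norm_sub_norm_le (I y) (I x)
      linarith
  obtain ⟨B, hB⟩ := bdd
  have hBn : 0 ≤ B := (norm_nonneg _).trans (hB a ⟨le_rfl, hab⟩)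
  set K1 : ℝ := 2 ^ (p - 1) with hK1
  set K2 : ℝ := 2 ^ (p - 1) * (C ^ p * ω a b ^ (p / ζ - 1)) with hK2
  set K3 : ℝ := (2 * B) ^ p / L with hK3
  have hωab := hω.1 a b le_rfl hab le_rfl
  have k1 : 0 ≤ K1 := by positivity
  have k2 : 0 ≤ K2 := by positivity
  have k3 : 0 ≤ K3 := by positivity
  have hpz : 1 ≤ p / ζ := by rw [le_div_iff₀ hζ0]; linarith [hζ.2]
  have main : ∀ s t, a ≤ s → s ≤ t → t ≤ b →
      ‖I t - I s‖ ^ p ≤ K1 * ω' s t + K2 * ω s t + K3 * ϖ s t := by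
    intro s t h1 h2 h3
    have p1 := hω'.1 s t h1 h2 h3
    have p2 := hω.1 s t h1 h2 h3
    have p3 := hϖ.1 s t h1 h2 h3
    by_cases h4 : ϖ s t ≤ L
    · have q1 : ‖I t - I s‖ ^ p ≤ (ω' s t ^ (1 / p) + C * ω s t ^ (1 / ζ)) ^ p :=
        Real.rpow_le_rpow (norm_nonneg _) (small s t h1 h2 h3 h4) hp0.le
      have q2 := real_add_rpow_le (Real.rpow_nonneg p1 (1 / p))
        (mul_nonneg hC.le (Real.rpow_nonneg p2 (1 / ζ))) hp
      have q3 : (ω' s t ^ (1 / p)) ^ p = ω' s t := by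
        rw [← Real.rpow_mul p1, one_div_mul_cancel hp0.ne', Real.rpow_one]
      have q4 : (C * ω s t ^ (1 / ζ)) ^ p = C ^ p * ω s t ^ (p / ζ) := by
        rw [Real.mul_rpow hC.le (by positivity), ← Real.rpow_mul p2]
        congr 2
        ring
      have q5 : ω s t ^ (p / ζ) ≤ ω a b ^ (p / ζ - 1) * ω s t := by
        have : ω s t ^ (p / ζ) = ω s t ^ (p / ζ - 1) * ω s t := by
          have e := Real.rpow_add_of_nonneg p2 (sub_nonneg.2 hpz) (zero_le_one)
          rwa [sub_add_cancel, Real.rpow_one] at e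
        rw [this]
        exact mul_le_mul_of_nonneg_right (Real.rpow_le_rpow p2 (control_mono hω h1 h2 h3)
          (sub_nonneg.2 hpz)) p2
      rw [q3, q4] at q2
      have q6 : 2 ^ (p - 1) * (ω' s t + C ^ p * ω s t ^ (p / ζ))
          ≤ K1 * ω' s t + K2 * ω s t := by
        have : K1 * ω' s t + K2 * ω s t
          = 2 ^ (p - 1) * (ω' s t + C ^ p * (ω a b ^ (p / ζ - 1) * ω s t)) := by
          rw [hK1, hK2]; ring
        rw [this]
        gcongr
      have q7 := mul_nonneg k3 p3
      linarith
    · have h4 := (not_le.1 h4).le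
      have q1 : ‖I t - I s‖ ≤ 2 * B := by
        have := norm_sub_le (I t) (I s)
        linarith [hB t ⟨h1.trans h2, h3⟩, hB s ⟨h1, h2.trans h3⟩]
      have q2 := Real.rpow_le_rpow (norm_nonneg _) q1 hp0.le
      have q3 : (2 * B) ^ p ≤ K3 * ϖ s t := by
        have : (2 * B) ^ p = K3 * L := by rw [hK3]; field_simp
        rw [this]
        exact mul_le_mul_of_nonneg_left h4 k3
      have := mul_nonneg k1 p1
      have := mul_nonneg k2 p2
      linarith
  refine ⟨K1 * ω' a b + K2 * ω a b + K3 * ϖ a b, ?_⟩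
  intro n τ h0 hn hlt
  have hm : ∀ i j, i ≤ j → j ≤ n → τ i ≤ τ j := by
    intro i j hij
    induction j, hij using Nat.le_induction with
    | base => intro _; exact le_rfl
    | succ j _ ih => intro hj; exact (ih (by omega)).trans (hlt j (by omega)).le
  calc ∑ i ∈ Finset.range n, ‖I (τ (i + 1)) - I (τ i)‖ ^ p
      ≤ ∑ i ∈ Finset.range n, (K1 * ω' (τ i) (τ (i + 1)) + K2 * ω (τ i) (τ (i + 1))
          + K3 * ϖ (τ i) (τ (i + 1))) := by
        refine Finset.sum_le_sum fun i hi => ?_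
        have hi := Finset.mem_range.1 hi
        exact main _ _ (h0 ▸ hm 0 i (Nat.zero_le _) hi.le) (hlt i hi).le
          (hn ▸ hm (i + 1) n hi le_rfl)
    _ ≤ _ := by
        rw [Finset.sum_add_distrib, Finset.sum_add_distrib, ← Finset.mul_sum, ← Finset.mul_sum,
          ← Finset.mul_sum]
        have c1 := control_sum hω' n τ h0 hm hn
        have c2 := control_sum hω n τ h0 hm hn
        have c3 := control_sum hϖ n τ h0 hm hn
        gcongr
end
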